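/- Let (G, Γ*) be a self-similar groupoid with associated inverse semigroup S_{(G,Γ*)}. Then S_{(G,Γ*)} is congruence-free if and only if: (1) |s⁻¹(v)| ≠ 1 for all v ∈ Γ⁰, and (2) for each pair of distinct vertices v, w ∈ Γ⁰ there exist paths p ∈ wΓ* and q ∈ vΓ* such that G intersects Iso(r(p), v) and G intersects Iso(r(q), w). -/

import Mathlib

set_option autoImplicit false

/-! ## Directed graphs and path trees -/

/-- A row-finite directed graph. -/
structure DirGraph where
  V : Type
  E : Type
  src : E → V
  rng : E → V
  rowFinite : ∀ v : V, {e : E | src e = v}.Finite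

/-- `Γ.IsPathFrom v l` : the list of edges `l` is a (finite) path with source `v`. -/
def DirGraph.IsPathFrom (Γ : DirGraph) : Γ.V → List Γ.E → Prop
  | _, [] => True
  | v, e :: l => Γ.src e = v ∧ DirGraph.IsPathFrom Γ (Γ.rng e) l

/-- The range (terminal vertex) of a path with source `v` and edge list `l`. -/
def DirGraph.rng0 (Γ : DirGraph) : Γ.V → List Γ.E → Γ.V
  | v, [] => v
  | _, e :: l => DirGraph.rng0 Γ (Γ.rng e) l

/-- An isomorphism of rooted path trees `(dom)Γ* → (cod)Γ*`: a bijection between the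
paths with source `dom` and the paths with source `cod` which fixes the root and maps
children to children (equivalently, a directed-graph isomorphism of the rooted trees). -/
structure Arrow (Γ : DirGraph) where
  dom : Γ.V
  cod : Γ.V
  act : List Γ.E → List Γ.E
  inv : List Γ.E → List Γ.E
  act_maps : ∀ l, Γ.IsPathFrom dom l → Γ.IsPathFrom cod (act l)
  inv_maps : ∀ l, Γ.IsPathFrom cod l → Γ.IsPathFrom dom (inv l)
  left_inv : ∀ l, Γ.IsPathFrom dom l → inv (act l) = l
  right_inv : ∀ l, Γ.IsPathFrom cod l → act (inv l) = l
  act_nil : act [] = []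
  act_snoc : ∀ l e, Γ.IsPathFrom dom (l ++ [e]) → ∃ e', act (l ++ [e]) = act l ++ [e']

/-- The identity tree isomorphism at a vertex `v`. -/
def Arrow.idArrow (Γ : DirGraph) (v : Γ.V) : Arrow Γ where
  dom := v
  cod := v
  act := fun l => l
  inv := fun l => l
  act_maps := fun _ h => h
  inv_maps := fun _ h => h
  left_inv := fun _ _ => rfl
  right_inv := fun _ _ => rfl
  act_nil := rfl
  act_snoc := fun _ e _ => ⟨e, rfl⟩

namespace Arrow

variable {Γ : DirGraph}

/-- Two arrows represent the same tree isomorphism (they agree on all genuine paths). -/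
def Same (g h : Arrow Γ) : Prop :=
  g.dom = h.dom ∧ g.cod = h.cod ∧ ∀ l, Γ.IsPathFrom g.dom l → g.act l = h.act l

/-- `k` represents the identity isomorphism of `v Γ*`. -/
def IsIdArrow (v : Γ.V) (k : Arrow Γ) : Prop :=
  k.dom = v ∧ k.cod = v ∧ ∀ l, Γ.IsPathFrom v l → k.act l = l

/-- `k` represents the composition `g ∘ h` (first `h`, then `g`). -/
def IsComposition (g h k : Arrow Γ) : Prop :=
  h.cod = g.dom ∧ k.dom = h.dom ∧ k.cod = g.cod ∧
  ∀ l, Γ.IsPathFrom h.dom l → k.act l = g.act (h.act l)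

/-- `k` represents the inverse isomorphism of `g`. -/
def IsInverseArrow (g k : Arrow Γ) : Prop :=
  k.dom = g.cod ∧ k.cod = g.dom ∧ ∀ l, Γ.IsPathFrom g.dom l → k.act (g.act l) = l

/-- `h` represents the restriction `g|_p` of `g` to the path `p`, characterized by
`g(pq) = g(p)·h(q)` for all paths `q` with source `r(p)`. -/
def IsRestrictOf (g : Arrow Γ) (p : List Γ.E) (h : Arrow Γ) : Prop :=
  h.dom = Γ.rng0 g.dom p ∧ h.cod = Γ.rng0 g.cod (g.act p) ∧
  ∀ q, Γ.IsPathFrom (Γ.rng0 g.dom p) q → g.act (p ++ q) = g.act p ++ h.act q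

end Arrow

/-! ## Self-similar groupoids -/

/-- A self-similar groupoid `(G, Γ*)` : a set of tree isomorphisms (closed under
representing-the-same-isomorphism) which contains all the identities, is closed under
composition and inverses (a groupoid with object set `Γ⁰` acting faithfully on `Γ*`),
and is closed under restriction: for every `g ∈ G` and edge `e` in the domain of `g`
there is `g|_e ∈ G` with `g(ep) = g(e)·g|_e(p)`. -/
structure SSG (Γ : DirGraph) where
  carrier : Set (Arrow Γ)
  satur : ∀ g g', g ∈ carrier → g.Same g' → g' ∈ carrier
  id_mem : ∀ v, Arrow.idArrow Γ v ∈ carrier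
  comp_mem : ∀ g h k, g ∈ carrier → h ∈ carrier → Arrow.IsComposition g h k → k ∈ carrier
  inv_mem : ∀ g k, g ∈ carrier → Arrow.IsInverseArrow g k → k ∈ carrier
  restrict_mem : ∀ g ∈ carrier, ∀ e : Γ.E, Γ.src e = g.dom →
    ∃ h ∈ carrier, g.IsRestrictOf [e] h

/-- The condition: for each pair of distinct vertices `v, w` there exist paths
`p ∈ wΓ*` and `q ∈ vΓ*` such that `G` intersects `Iso(r(p), v)` and `Iso(r(q), w)`. -/
def OrbitCond (Γ : DirGraph) (Gs : SSG Γ) : Prop :=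
  ∀ v w : Γ.V, v ≠ w →
    (∃ p, Γ.IsPathFrom w p ∧ ∃ g ∈ Gs.carrier, g.dom = Γ.rng0 w p ∧ g.cod = v) ∧
    (∃ q, Γ.IsPathFrom v q ∧ ∃ g ∈ Gs.carrier, g.dom = Γ.rng0 v q ∧ g.cod = w)

/-- Type (CF): every vertex emits more than one edge, and the orbit condition holds. -/
def TypeCF (Γ : DirGraph) (Gs : SSG Γ) : Prop :=
  (∀ v : Γ.V, ∃ e f : Γ.E, e ≠ f ∧ Γ.src e = v ∧ Γ.src f = v) ∧ OrbitCond Γ Gs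

/-! ## Contracting self-similar groupoids, nuclei, recurrent subgroups -/

/-- Every element of `G` eventually restricts into `A`. -/
def ContractsInto {Γ : DirGraph} (Gs : SSG Γ) (A : Set (Arrow Γ)) : Prop :=
  ∀ g ∈ Gs.carrier, ∃ n : ℕ, ∀ l, Γ.IsPathFrom g.dom l → l.length = n →
    ∃ h ∈ A, g.IsRestrictOf l h

/-- A set of arrows covering only finitely many tree isomorphisms. -/
def FinUpToSame {Γ : DirGraph} (A : Set (Arrow Γ)) : Prop :=
  ∃ B : Finset (Arrow Γ), ∀ g ∈ A, ∃ h ∈ B, g.Same h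

/-- `(G, Γ*)` is contracting. -/
def IsContracting {Γ : DirGraph} (Gs : SSG Γ) : Prop :=
  ∃ A : Set (Arrow Γ), A ⊆ Gs.carrier ∧ FinUpToSame A ∧ ContractsInto Gs A

/-- `N` is the nucleus of `(G, Γ*)` : a minimal finite subset of `G` into which every
element of `G` eventually restricts. -/
def IsNucleus {Γ : DirGraph} (Gs : SSG Γ) (N : Set (Arrow Γ)) : Prop :=
  N ⊆ Gs.carrier ∧ FinUpToSame N ∧ ContractsInto Gs N ∧
  ∀ A : Set (Arrow Γ), A ⊆ Gs.carrier → FinUpToSame A → ContractsInto Gs A →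
    ∀ g ∈ N, ∃ h ∈ A, g.Same h

/-- The recurrent set `H_p = {g ∈ G : g(p) = p, g|_p = g}` for a path `p ∈ vΓ*`. -/
def Hp {Γ : DirGraph} (Gs : SSG Γ) (v : Γ.V) (p : List Γ.E) : Set (Arrow Γ) :=
  {g | g ∈ Gs.carrier ∧ g.dom = v ∧ g.cod = v ∧ g.act p = p ∧ g.IsRestrictOf p g}

/-! ## The associated inverse semigroup `S_{(G,Γ*)}` -/

/-- The product in `S` of a path: `p = e₁ e₂ ⋯ eₙ · r(p)` (just `v` for the empty path). -/
def pathProd {Γ : DirGraph} {S : Type} (mul : S → S → S) (ιV : Γ.V → S) (ιE : Γ.E → S)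
    (v : Γ.V) (p : List Γ.E) : S :=
  p.foldr (fun e a => mul (ιE e) a) (ιV (Γ.rng0 v p))

/-- The inverse semigroup with zero `S_{(G,Γ*)}` associated to a self-similar groupoid,
presented through its characterizing properties: it is an inverse semigroup with zero,
generated by `Γ⁰ ∪ Γ¹ ∪ Γ⁻¹ ∪ G` subject to the defining relations, in which every
nonzero element has a unique canonical form `p g q*`. -/
structure AssocISG (Γ : DirGraph) (Gs : SSG Γ) where
  S : Type
  mul : S → S → S
  zero : S
  star : S → S
  mul_assoc : ∀ a b c, mul (mul a b) c = mul a (mul b c)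
  zero_mul : ∀ a, mul zero a = zero
  mul_zero : ∀ a, mul a zero = zero
  inv_ax : ∀ a, mul (mul a (star a)) a = a ∧ mul (mul (star a) a) (star a) = star a
  inv_unique : ∀ a b, mul (mul a b) a = a → mul (mul b a) b = b → b = star a
  ιV : Γ.V → S
  ιE : Γ.E → S
  ιG : Arrow Γ → S
  ιG_same : ∀ g h, g.Same h → ιG g = ιG h
  rel_src : ∀ e, mul (ιV (Γ.src e)) (ιE e) = ιE e
  rel_rng : ∀ e, mul (ιE e) (ιV (Γ.rng e)) = ιE e
  rel_vv : ∀ u v, u ≠ v → mul (ιV u) (ιV v) = zero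
  rel_v_idem : ∀ v, mul (ιV v) (ιV v) = ιV v
  rel_star_v : ∀ v, star (ιV v) = ιV v
  rel_ef : ∀ e f, e ≠ f → mul (star (ιE e)) (ιE f) = zero
  rel_ee : ∀ e, mul (star (ιE e)) (ιE e) = ιV (Γ.rng e)
  rel_comp : ∀ g h k, g ∈ Gs.carrier → h ∈ Gs.carrier → Arrow.IsComposition g h k →
    mul (ιG g) (ιG h) = ιG k
  rel_notcomp : ∀ g h, g ∈ Gs.carrier → h ∈ Gs.carrier → h.cod ≠ g.dom →
    mul (ιG g) (ιG h) = zero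
  rel_star : ∀ g k, g ∈ Gs.carrier → Arrow.IsInverseArrow g k → star (ιG g) = ιG k
  rel_id : ∀ v, ιG (Arrow.idArrow Γ v) = ιV v
  rel_ge : ∀ g ∈ Gs.carrier, ∀ (e e' : Γ.E) (h : Arrow Γ), Γ.src e = g.dom →
    g.act [e] = [e'] → g.IsRestrictOf [e] h → mul (ιG g) (ιE e) = mul (ιE e') (ιG h)
  canon_ex : ∀ s, s ≠ zero → ∃ (v w : Γ.V) (p q : List Γ.E) (g : Arrow Γ),
    Γ.IsPathFrom v p ∧ Γ.IsPathFrom w q ∧ g ∈ Gs.carrier ∧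
    g.dom = Γ.rng0 w q ∧ g.cod = Γ.rng0 v p ∧
    s = mul (mul (pathProd mul ιV ιE v p) (ιG g)) (star (pathProd mul ιV ιE w q))
  canon_nonzero : ∀ (v w : Γ.V) (p q : List Γ.E) (g : Arrow Γ),
    Γ.IsPathFrom v p → Γ.IsPathFrom w q → g ∈ Gs.carrier →
    g.dom = Γ.rng0 w q → g.cod = Γ.rng0 v p →
    mul (mul (pathProd mul ιV ιE v p) (ιG g)) (star (pathProd mul ιV ιE w q)) ≠ zero
  canon_inj : ∀ (v w v' w' : Γ.V) (p q p' q' : List Γ.E) (g g' : Arrow Γ),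
    Γ.IsPathFrom v p → Γ.IsPathFrom w q → g ∈ Gs.carrier →
    g.dom = Γ.rng0 w q → g.cod = Γ.rng0 v p →
    Γ.IsPathFrom v' p' → Γ.IsPathFrom w' q' → g' ∈ Gs.carrier →
    g'.dom = Γ.rng0 w' q' → g'.cod = Γ.rng0 v' p' →
    mul (mul (pathProd mul ιV ιE v p) (ιG g)) (star (pathProd mul ιV ιE w q)) =
      mul (mul (pathProd mul ιV ιE v' p') (ιG g')) (star (pathProd mul ιV ιE w' q')) →
    v = v' ∧ w = w' ∧ p = p' ∧ q = q' ∧ g.Same g'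

namespace AssocISG

variable {Γ : DirGraph} {Gs : SSG Γ}

/-- The element of `S` represented by a path. -/
def P (T : AssocISG Γ Gs) (v : Γ.V) (p : List Γ.E) : T.S :=
  pathProd T.mul T.ιV T.ιE v p

def IsIdem (T : AssocISG Γ Gs) (e : T.S) : Prop := T.mul e e = e

/-- The natural partial order on idempotents: `f ≤ e` iff `f = g e` for an idempotent `g`. -/
def idemLe (T : AssocISG Γ Gs) (f e : T.S) : Prop := ∃ g, T.IsIdem g ∧ f = T.mul g e

/-- A congruence on `S`. -/
def IsCongruence (T : AssocISG Γ Gs) (r : T.S → T.S → Prop) : Prop :=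
  Equivalence r ∧ ∀ a b c, r a b → r (T.mul c a) (T.mul c b) ∧ r (T.mul a c) (T.mul b c)

/-- `S` is congruence-free: its only congruences are equality and the universal relation. -/
def CongruenceFree (T : AssocISG Γ Gs) : Prop :=
  ∀ r, T.IsCongruence r → (∀ a b, r a b ↔ a = b) ∨ (∀ a b, r a b)

/-- `S` is fundamental. -/
def Fundamental (T : AssocISG Γ Gs) : Prop :=
  ∀ a b : T.S,
    (∀ e, T.IsIdem e → T.mul (T.mul a e) (T.star a) = T.mul (T.mul b e) (T.star b)) → a = b

/-- `S` is 0-simple: its only (two-sided semigroup) ideals are `{0}` and `S`. -/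
def ZeroSimple (T : AssocISG Γ Gs) : Prop :=
  ∀ J : Set T.S, J.Nonempty → (∀ s x, x ∈ J → T.mul s x ∈ J ∧ T.mul x s ∈ J) →
    J = {T.zero} ∨ J = Set.univ

/-- The semilattice of idempotents of `S` is 0-disjunctive. -/
def ZeroDisjunctive (T : AssocISG Γ Gs) : Prop :=
  ∀ e f, T.IsIdem e → T.IsIdem f → e ≠ T.zero → f ≠ T.zero → e ≠ f →
    ∃ h, T.IsIdem h ∧ Xor' (T.mul e h = T.zero) (T.mul f h = T.zero)

end AssocISG

/-! ## The contracted inverse semigroup algebra `K S_{(G,Γ*)}` -/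

/-- The contracted inverse semigroup algebra of `S_{(G,Γ*)}` over a field `K` :
a (possibly nonunital) `K`-algebra with basis `S ∖ {0}` and multiplication extending
that of `S` (identifying the zeros of `S` and `K`). -/
structure ContractedAlg (K : Type) [Field K] {Γ : DirGraph} {Gs : SSG Γ}
    (T : AssocISG Γ Gs) where
  A : Type
  [ringA : NonUnitalRing A]
  [modA : Module K A]
  smul_mul : ∀ (k : K) (a b : A), (k • a) * b = k • (a * b)
  mul_smul_comm : ∀ (k : K) (a b : A), a * (k • b) = k • (a * b)
  δ : T.S → A
  δ_zero : δ T.zero = 0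
  δ_mul : ∀ s t, δ (T.mul s t) = δ s * δ t
  indep : LinearIndependent K (fun s : {s : T.S // s ≠ T.zero} => δ s.1)
  spans : ∀ a : A, a ∈ Submodule.span K (Set.range (fun s : {s : T.S // s ≠ T.zero} => δ s.1))

attribute [instance] ContractedAlg.ringA ContractedAlg.modA

/-- Product of a list in a (nonunital) ring, with the empty product read as `0`. -/
def listProd {A : Type} [Mul A] [Zero A] : List A → A
  | [] => 0
  | a :: l => l.foldl (· * ·) a

namespace ContractedAlg

variable {K : Type} [Field K] {Γ : DirGraph} {Gs : SSG Γ} {T : AssocISG Γ Gs}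

/-- A (two-sided, `K`-linear) ideal of the algebra, as a set. -/
def IsIdealSet (C : ContractedAlg K T) (J : Set C.A) : Prop :=
  (0 : C.A) ∈ J ∧ (∀ x y, x ∈ J → y ∈ J → x + y ∈ J) ∧ (∀ x, x ∈ J → -x ∈ J) ∧
  (∀ (k : K) x, x ∈ J → k • x ∈ J) ∧
  (∀ x y, x ∈ J → y * x ∈ J) ∧ (∀ x y, x ∈ J → x * y ∈ J)

/-- The ideal generated by a set. -/
def idealGen (C : ContractedAlg K T) (X : Set C.A) : Set C.A :=
  ⋂₀ {J | C.IsIdealSet J ∧ X ⊆ J}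

/-- The generators `∏_{f ∈ F} (e - f)` of the tight ideal, for `e` a nonzero idempotent
and `F` a finite cover of `e`. -/
def tightGens (C : ContractedAlg K T) : Set C.A :=
  {x | ∃ (e : T.S) (l : List T.S), T.IsIdem e ∧ e ≠ T.zero ∧ l ≠ [] ∧
    (∀ f ∈ l, T.IsIdem f ∧ T.idemLe f e) ∧
    (∀ g, T.IsIdem g → g ≠ T.zero → T.idemLe g e → ∃ f ∈ l, T.mul g f ≠ T.zero) ∧
    x = listProd (l.map fun f => C.δ e - C.δ f)}

/-- The tight ideal of `K S_{(G,Γ*)}`. -/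
def Itight (C : ContractedAlg K T) : Set C.A := C.idealGen C.tightGens

/-- The Cuntz–Krieger generators `v - ∑_{e ∈ vΓ¹} e e*`. -/
def ckGens (C : ContractedAlg K T) : Set C.A :=
  {x | ∃ v : Γ.V,
    x = C.δ (T.ιV v) -
      ∑ e ∈ (Γ.rowFinite v).toFinset, C.δ (T.mul (T.ιE e) (T.star (T.ιE e)))}

/-- The Cuntz–Krieger ideal of `K S_{(G,Γ*)}`. -/
def Ick (C : ContractedAlg K T) : Set C.A := C.idealGen C.ckGens

/-- An element `a` is singular: for every nonzero idempotent `e` there is a nonzero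
idempotent `f ≤ e` with `a f = 0`. -/
def IsSingular (C : ContractedAlg K T) (a : C.A) : Prop :=
  ∀ e, T.IsIdem e → e ≠ T.zero →
    ∃ f, T.IsIdem f ∧ f ≠ T.zero ∧ T.idemLe f e ∧ a * C.δ f = 0

/-- The essential (singular) ideal of `K S_{(G,Γ*)}`. -/
def Iess (C : ContractedAlg K T) : Set C.A := {a | C.IsSingular a}

/-- The quotient of the algebra by the ideal `I` is simple. -/
def QuotSimple (C : ContractedAlg K T) (I : Set C.A) : Prop :=
  I ≠ Set.univ ∧ ∀ J, C.IsIdealSet J → I ⊆ J → J = I ∨ J = Set.univ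

end ContractedAlg
/-! ## Collapsing self-similar groupoids -/

/-- A morphism of directed graphs. -/
structure GraphHom (Γ Λ : DirGraph) where
  vmap : Γ.V → Λ.V
  emap : Γ.E → Λ.E
  hsrc : ∀ e, Λ.src (emap e) = vmap (Γ.src e)
  hrng : ∀ e, Λ.rng (emap e) = vmap (Γ.rng e)

/-- The induced map on paths. -/
def GraphHom.pmap {Γ Λ : DirGraph} (β : GraphHom Γ Λ) (l : List Γ.E) : List Λ.E :=
  l.map β.emap

/-- `F` is a system of collapsing isomorphisms for `(G, Γ*)` : a wide subgroupoid of `G`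
containing all identities, with at most one arrow between any two objects, and with an
arrow `u → v` whenever `G` has one (as produced by choosing orbit representatives `R`
and isomorphisms `f_u` with `id_u = f_u⁻¹ id_v f_u`). -/
def IsFsystem {Γ : DirGraph} (Gs : SSG Γ) (F : Set (Arrow Γ)) : Prop :=
  F ⊆ Gs.carrier ∧
  (∀ g g', g ∈ F → g.Same g' → g' ∈ F) ∧
  (∀ v, Arrow.idArrow Γ v ∈ F) ∧
  (∀ g h k, g ∈ F → h ∈ F → Arrow.IsComposition g h k → k ∈ F) ∧
  (∀ g k, g ∈ F → Arrow.IsInverseArrow g k → k ∈ F) ∧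
  (∀ g g', g ∈ F → g' ∈ F → g.dom = g'.dom → g.cod = g'.cod → g.Same g') ∧
  (∀ g ∈ Gs.carrier, ∃ f ∈ F, f.dom = g.dom ∧ f.cod = g.cod)

/-- `β : Γ → Λ` is the quotient graph morphism determined by `F` : it is surjective and
locally bijective, its vertex fibres are exactly the `F`-orbits of vertices, and it is
invariant under the action of `F` on paths (so that the fibres on paths are exactly the
`∼_F`-classes). -/
def IsCollapse {Γ Λ : DirGraph} (Gs : SSG Γ) (F : Set (Arrow Γ)) (β : GraphHom Γ Λ) : Prop :=
  Function.Surjective β.vmap ∧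
  (∀ v : Γ.V, Set.BijOn β.emap {e | Γ.src e = v} {e' | Λ.src e' = β.vmap v}) ∧
  (∀ u v : Γ.V, β.vmap u = β.vmap v ↔ ∃ f ∈ F, f.dom = u ∧ f.cod = v) ∧
  (∀ f ∈ F, ∀ l, Γ.IsPathFrom f.dom l → β.pmap (f.act l) = β.pmap l)

/-- `m` is the tree isomorphism of `Λ*` induced by `g` under the identification `β`
(the image `α(g)` of `g` in the collapsed groupoid). -/
def IsPushArrow {Γ Λ : DirGraph} (β : GraphHom Γ Λ) (g : Arrow Γ) (m : Arrow Λ) : Prop :=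
  m.dom = β.vmap g.dom ∧ m.cod = β.vmap g.cod ∧
  ∀ l, Γ.IsPathFrom g.dom l → m.act (β.pmap l) = β.pmap (g.act l)

/-- The collapsed groupoid `L = α(G)`, acting on `Λ*`. -/
def Lcarrier {Γ Λ : DirGraph} (Gs : SSG Γ) (β : GraphHom Γ Λ) : Set (Arrow Λ) :=
  {m | ∃ g ∈ Gs.carrier, IsPushArrow β g m}

/-! ## The graph Δ : cycles of the Moore diagram, the sets `I_q`, synchronization -/

/-- Membership in `N` up to representing the same tree isomorphism. -/
def memSame {Γ : DirGraph} (N : Set (Arrow Γ)) (g : Arrow Γ) : Prop :=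
  ∃ h ∈ N, g.Same h

/-- The set `C` of elements of the nucleus `N` lying on a nonempty cycle of the subgraph
`H` of the Moore diagram of `N` consisting of the edges labelled `(e, e)` : `g ∈ C` iff
`g ∈ N` and there is a nonempty path `p` with `g(p) = p`, `g|_p = g`, and all the
intermediate restrictions `g|_{p'}` (for prefixes `p'` of `p`) in `N`. -/
def Cset {Γ : DirGraph} (N : Set (Arrow Γ)) : Set (Arrow Γ) :=
  {g | memSame N g ∧ ∃ p : List Γ.E, p ≠ [] ∧ Γ.IsPathFrom g.dom p ∧ g.act p = p ∧
    g.IsRestrictOf p g ∧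
    ∀ l₁ l₂ : List Γ.E, p = l₁ ++ l₂ → ∃ h, memSame N h ∧ g.IsRestrictOf l₁ h}

/-- The vertex `I_q = q · {id_{r(q)}} = {g ∈ C : g(q) = q, g|_q = id}` of `Δ`,
for a path `q ∈ vΓ*`. -/
def Iq {Γ : DirGraph} (N : Set (Arrow Γ)) (v : Γ.V) (q : List Γ.E) : Set (Arrow Γ) :=
  {g | g ∈ Cset N ∧ g.dom = v ∧ g.cod = v ∧
    ∀ w, Γ.IsPathFrom (Γ.rng0 v q) w → g.act (q ++ w) = q ++ w}

/-- The path `p ∈ vΓ*` is synchronizing in `Δ` : every path of `Δ` labelled by the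
reversal of `p` ends at the same vertex, i.e. `I_{pq} = I_{pq'}` for all `q, q' ∈ r(p)Γ*`. -/
def Synchronizing {Γ : DirGraph} (N : Set (Arrow Γ)) (v : Γ.V) (p : List Γ.E) : Prop :=
  Γ.IsPathFrom v p ∧
  ∀ q q', Γ.IsPathFrom (Γ.rng0 v p) q → Γ.IsPathFrom (Γ.rng0 v p) q' →
    Iq N v (p ++ q) = Iq N v (p ++ q')

/-- A vertex `X` of `Δ` is synchronized: `X = I_w` for some synchronizing path `w`. -/
def SyncVertex {Γ : DirGraph} (N : Set (Arrow Γ)) (X : Set (Arrow Γ)) : Prop :=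
  ∃ v p, Synchronizing N v p ∧ X = Iq N v p

/-- The vertex set `Q = {I_q : q ∈ Γ*}` of the Schreier graph `Δ`. -/
def Qset {Γ : DirGraph} (N : Set (Arrow Γ)) : Set (Set (Arrow Γ)) :=
  {X | ∃ v q, Γ.IsPathFrom v q ∧ X = Iq N v q}

/-- The edge relation of `Δ` : an edge labelled `e` from `I_q` to `I_{eq}`. -/
def DeltaStep {Γ : DirGraph} (N : Set (Arrow Γ)) (X Y : Set (Arrow Γ)) : Prop :=
  ∃ v q e, Γ.IsPathFrom v q ∧ Γ.rng e = v ∧ X = Iq N v q ∧ Y = Iq N (Γ.src e) (e :: q)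

/-- Reachability in `Δ`. -/
def DeltaReaches {Γ : DirGraph} (N : Set (Arrow Γ)) : Set (Arrow Γ) → Set (Arrow Γ) → Prop :=
  Relation.ReflTransGen (DeltaStep N)

/-- A vertex of `Δ` lying in a minimal strongly connected component with respect to
reachability. -/
def DeltaMinVert {Γ : DirGraph} (N : Set (Arrow Γ)) (X : Set (Arrow Γ)) : Prop :=
  X ∈ Qset N ∧ ∀ Y ∈ Qset N, DeltaReaches N X Y → DeltaReaches N Y X

/- `π_{p,q}(a) = 0` for `a = ∑_{g ∈ Tset} c_g · g ∈ K H_p`, where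
`π_{p,q} : K H_p → K[H_p / (H_p ∩ I_q)]` is induced by the canonical map of `H_p` onto
the left cosets of `H_p ∩ I_q` : the sum of the coefficients over each left coset of
`H_p ∩ I_q` vanishes. -/
open Classical in
def PiZero (K : Type) [Field K] {Γ : DirGraph} (Gs : SSG Γ) (N : Set (Arrow Γ))
    (v : Γ.V) (p q : List Γ.E) (Tset : Finset (Arrow Γ)) (c : Arrow Γ → K) : Prop :=
  ∀ g₀ ∈ Hp Gs v p,
    (∑ h ∈ Tset,
      if ∃ k, k ∈ Hp Gs v p ∧ k ∈ Iq N v q ∧ Arrow.IsComposition g₀ k h then c h else 0) = 0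

/-! ## STATEMENT 0 -/

namespace DirGraph

variable {Γ : DirGraph}

theorem isPathFrom_append {v : Γ.V} {p q : List Γ.E} :
    Γ.IsPathFrom v (p ++ q) ↔ Γ.IsPathFrom v p ∧ Γ.IsPathFrom (Γ.rng0 v p) q := by
  induction p generalizing v with
  | nil => simp [IsPathFrom, rng0]
  | cons e p ih => simp [IsPathFrom, rng0, ih, and_assoc]

end DirGraph

namespace Arrow

variable {Γ : DirGraph}

theorem inv_nil (g : Arrow Γ) : g.inv [] = [] := by
  simpa [g.act_nil] using g.left_inv [] trivial

/-- The inverse of a tree isomorphism. -/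
def symm (g : Arrow Γ) : Arrow Γ where
  dom := g.cod
  cod := g.dom
  act := g.inv
  inv := g.act
  act_maps := g.inv_maps
  inv_maps := g.act_maps
  left_inv := g.right_inv
  right_inv := g.left_inv
  act_nil := g.inv_nil
  act_snoc := by
    intro l e hl
    have hact := g.right_inv _ hl
    have hpath := g.inv_maps _ hl
    rcases List.eq_nil_or_concat (g.inv (l ++ [e])) with h | ⟨m, e', h⟩
    · rw [h, g.act_nil] at hact
      simp at hact
    · rw [List.concat_eq_append] at h
      rw [h] at hact hpath
      obtain ⟨f, hf⟩ := g.act_snoc m e' hpath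
      have hm : g.act m = l := by
        rw [hf] at hact
        exact (List.append_inj' hact rfl).1
      refine ⟨e', ?_⟩
      rw [h, ← hm, g.left_inv m (DirGraph.isPathFrom_append.1 hpath).1]

theorem act_singleton (g : Arrow Γ) {e : Γ.E} (he : Γ.src e = g.dom) :
    ∃ e', g.act [e] = [e'] := by
  simpa [g.act_nil] using g.act_snoc [] e ⟨he, trivial⟩

end Arrow

namespace AssocISG

variable {Γ : DirGraph} {Gs : SSG Γ} (T : AssocISG Γ Gs)

instance : SemigroupWithZero T.S where
  mul := T.mul
  zero := T.zero
  mul_assoc := T.mul_assoc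
  zero_mul := T.zero_mul
  mul_zero := T.mul_zero

theorem mul_star_mul (a : T.S) : a * (T.star a * a) = a := by
  rw [← _root_.mul_assoc]; exact (T.inv_ax a).1

theorem star_mul_star (a : T.S) : T.star a * (a * T.star a) = T.star a := by
  rw [← _root_.mul_assoc]; exact (T.inv_ax a).2

theorem eq_star {a b : T.S} (h₁ : a * (b * a) = a) (h₂ : b * (a * b) = b) : b = T.star a :=
  T.inv_unique a b (by rw [← _root_.mul_assoc] at h₁; exact h₁) (by rw [← _root_.mul_assoc] at h₂; exact h₂)

theorem V_mul_V (v : Γ.V) : T.ιV v * T.ιV v = T.ιV v := T.rel_v_idem v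

theorem V_mul_V_of_ne {u v : Γ.V} (h : u ≠ v) : T.ιV u * T.ιV v = 0 := T.rel_vv u v h

theorem star_V (v : Γ.V) : T.star (T.ιV v) = T.ιV v := T.rel_star_v v

theorem V_mul_E (e : Γ.E) : T.ιV (Γ.src e) * T.ιE e = T.ιE e := T.rel_src e

theorem E_mul_V (e : Γ.E) : T.ιE e * T.ιV (Γ.rng e) = T.ιE e := T.rel_rng e

theorem star_E_mul_E (e : Γ.E) : T.star (T.ιE e) * T.ιE e = T.ιV (Γ.rng e) := T.rel_ee e

theorem star_E_mul_E_of_ne {e f : Γ.E} (h : e ≠ f) : T.star (T.ιE e) * T.ιE f = 0 :=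
  T.rel_ef e f h

theorem P_nil (v : Γ.V) : T.P v [] = T.ιV v := rfl

theorem P_cons (v : Γ.V) (e : Γ.E) (p : List Γ.E) :
    T.P v (e :: p) = T.ιE e * T.P (Γ.rng e) p := rfl

theorem V_mul_P {v : Γ.V} {p : List Γ.E} (hp : Γ.IsPathFrom v p) :
    T.ιV v * T.P v p = T.P v p := by
  cases p with
  | nil => exact T.V_mul_V v
  | cons e p =>
    obtain ⟨rfl, -⟩ := hp
    rw [P_cons, ← _root_.mul_assoc, V_mul_E]

theorem P_mul_V (v : Γ.V) (p : List Γ.E) : T.P v p * T.ιV (Γ.rng0 v p) = T.P v p := by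
  induction p generalizing v with
  | nil => exact T.V_mul_V v
  | cons e p ih =>
    rw [P_cons, _root_.mul_assoc]
    exact congrArg _ (ih _)

theorem P_append (v : Γ.V) (p : List Γ.E) {q : List Γ.E}
    (hq : Γ.IsPathFrom (Γ.rng0 v p) q) :
    T.P v (p ++ q) = T.P v p * T.P (Γ.rng0 v p) q := by
  induction p generalizing v with
  | nil => exact (T.V_mul_P hq).symm
  | cons e p ih =>
    rw [List.cons_append, P_cons, P_cons, ih _ hq, _root_.mul_assoc]
    rfl

theorem star_E_mul_V (e : Γ.E) : T.star (T.ιE e) * T.ιV (Γ.src e) = T.star (T.ιE e) := by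
  apply T.eq_star
  · rw [_root_.mul_assoc, V_mul_E, mul_star_mul]
  · rw [_root_.mul_assoc, ← _root_.mul_assoc (T.ιV _) (T.ιE e), V_mul_E, ← _root_.mul_assoc (T.ιE e),
      ← _root_.mul_assoc, star_mul_star]

theorem star_P_cons (v : Γ.V) (e : Γ.E) {p : List Γ.E} (hp : Γ.IsPathFrom (Γ.rng e) p) :
    T.star (T.P v (e :: p)) = T.star (T.P (Γ.rng e) p) * T.star (T.ιE e) := by
  symm
  apply T.eq_star
  · rw [P_cons, _root_.mul_assoc, _root_.mul_assoc, ← _root_.mul_assoc (T.star (T.ιE e)), star_E_mul_E, V_mul_P T hp,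
      mul_star_mul]
  · rw [P_cons, _root_.mul_assoc, ← _root_.mul_assoc (T.star (T.ιE e)), ← _root_.mul_assoc (T.star (T.ιE e)),
      star_E_mul_E, V_mul_P T hp, ← _root_.mul_assoc (T.P _ _), ← _root_.mul_assoc (T.star (T.P _ _)),
      star_mul_star]

theorem star_P_mul_P {v : Γ.V} {p : List Γ.E} (hp : Γ.IsPathFrom v p) :
    T.star (T.P v p) * T.P v p = T.ιV (Γ.rng0 v p) := by
  induction p generalizing v with
  | nil => rw [P_nil, star_V]; exact T.V_mul_V v
  | cons e p ih =>
    rw [star_P_cons T v e hp.2, P_cons, _root_.mul_assoc, ← _root_.mul_assoc (T.star (T.ιE e)), star_E_mul_E,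
      V_mul_P T hp.2, ih hp.2]
    rfl

theorem star_P_mul_V {v : Γ.V} {p : List Γ.E} (hp : Γ.IsPathFrom v p) :
    T.star (T.P v p) * T.ιV v = T.star (T.P v p) := by
  cases p with
  | nil => rw [P_nil, star_V]; exact T.V_mul_V v
  | cons e p =>
    obtain ⟨rfl, hp⟩ := hp
    rw [star_P_cons T _ e hp, _root_.mul_assoc, star_E_mul_V]

theorem star_P_append {v : Γ.V} {p q : List Γ.E} (hp : Γ.IsPathFrom v p)
    (hq : Γ.IsPathFrom (Γ.rng0 v p) q) :
    T.star (T.P v (p ++ q)) = T.star (T.P (Γ.rng0 v p) q) * T.star (T.P v p) := by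
  symm
  apply T.eq_star
  · rw [P_append T v p hq]
    simp only [_root_.mul_assoc]
    rw [← _root_.mul_assoc (T.star (T.P v p)), star_P_mul_P T hp, V_mul_P T hq, mul_star_mul]
  · rw [P_append T v p hq]
    simp only [_root_.mul_assoc]
    rw [← _root_.mul_assoc (T.star (T.P v p)) (T.P v p), star_P_mul_P T hp,
      ← _root_.mul_assoc (T.ιV _), V_mul_P T hq, ← _root_.mul_assoc (T.P (Γ.rng0 v p) q),
      ← _root_.mul_assoc (T.star (T.P (Γ.rng0 v p) q)), star_mul_star]

theorem V_mul_G {g : Arrow Γ} (hg : g ∈ Gs.carrier) : T.ιV g.cod * T.ιG g = T.ιG g := by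
  rw [← T.rel_id]
  exact T.rel_comp _ _ _ (Gs.id_mem _) hg ⟨rfl, rfl, rfl, fun _ _ => rfl⟩

theorem G_mul_V {g : Arrow Γ} (hg : g ∈ Gs.carrier) : T.ιG g * T.ιV g.dom = T.ιG g := by
  rw [← T.rel_id]
  exact T.rel_comp _ _ _ hg (Gs.id_mem _) ⟨rfl, rfl, rfl, fun _ _ => rfl⟩

theorem symm_mem {g : Arrow Γ} (hg : g ∈ Gs.carrier) : g.symm ∈ Gs.carrier :=
  Gs.inv_mem g _ hg ⟨rfl, rfl, g.left_inv⟩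

theorem G_symm_mul_G {g : Arrow Γ} (hg : g ∈ Gs.carrier) :
    T.ιG g.symm * T.ιG g = T.ιV g.dom := by
  rw [← T.rel_id]
  exact T.rel_comp _ _ _ (symm_mem hg) hg ⟨rfl, rfl, rfl, fun l hl => (g.left_inv l hl).symm⟩

theorem G_mul_G_symm {g : Arrow Γ} (hg : g ∈ Gs.carrier) :
    T.ιG g * T.ιG g.symm = T.ιV g.cod := by
  rw [← T.rel_id]
  exact T.rel_comp _ _ _ hg (symm_mem hg) ⟨rfl, rfl, rfl, fun l hl => (g.right_inv l hl).symm⟩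

/-- Moving a groupoid element past a path. -/
theorem G_mul_P {g : Arrow Γ} (hg : g ∈ Gs.carrier) {z : List Γ.E}
    (hz : Γ.IsPathFrom g.dom z) :
    (g.act z).length = z.length ∧ ∃ k ∈ Gs.carrier, k.dom = Γ.rng0 g.dom z ∧
      k.cod = Γ.rng0 g.cod (g.act z) ∧
      T.ιG g * T.P g.dom z = T.P g.cod (g.act z) * T.ιG k := by
  induction z generalizing g with
  | nil =>
    rw [g.act_nil]
    exact ⟨rfl, g, hg, rfl, rfl, (T.G_mul_V hg).trans (T.V_mul_G hg).symm⟩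
  | cons e z ih =>
    obtain ⟨h, hh, hres⟩ := Gs.restrict_mem g hg e hz.1
    obtain ⟨e', he'⟩ := g.act_singleton hz.1
    have hge : T.ιG g * T.ιE e = T.ιE e' * T.ιG h := T.rel_ge g hg e e' h hz.1 he' hres
    obtain ⟨hdom, hcod, hact⟩ := hres
    rw [he'] at hcod hact
    have hdom : h.dom = Γ.rng e := hdom
    have hcod : h.cod = Γ.rng e' := hcod
    have hez : g.act (e :: z) = e' :: h.act z := hact z hz.2
    obtain ⟨hlen, k, hk, hkd, hkc, hkP⟩ := ih hh (hdom ▸ hz.2)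
    rw [hez]
    refine ⟨by simp [hlen], k, hk, ?_, ?_, ?_⟩
    · rw [hkd, hdom]; rfl
    · rw [hkc, hcod]; rfl
    · rw [P_cons, P_cons, ← _root_.mul_assoc, hge, _root_.mul_assoc, ← hdom, hkP, hcod, _root_.mul_assoc]

theorem G_ne_zero {g : Arrow Γ} (hg : g ∈ Gs.carrier) : T.ιG g ≠ 0 := by
  have h : T.ιV g.cod * T.ιG g * T.star (T.ιV g.dom) ≠ 0 :=
    T.canon_nonzero g.cod g.dom [] [] g trivial trivial hg rfl rfl
  rwa [V_mul_G T hg, star_V, G_mul_V T hg] at h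

theorem V_ne_zero (v : Γ.V) : T.ιV v ≠ 0 := by
  rw [← T.rel_id]
  exact T.G_ne_zero (Gs.id_mem v)

theorem G_mul_P_ne_zero {g : Arrow Γ} (hg : g ∈ Gs.carrier) {z : List Γ.E}
    (hz : Γ.IsPathFrom g.dom z) : T.ιG g * T.P g.dom z ≠ 0 := by
  intro h
  apply T.V_ne_zero (Γ.rng0 g.dom z)
  rw [← star_P_mul_P T hz, ← V_mul_P T hz, ← G_symm_mul_G T hg, _root_.mul_assoc (T.ιG _), h, MulZeroClass.mul_zero,
    MulZeroClass.mul_zero]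

theorem star_P_mul_G_ne_zero {g : Arrow Γ} (hg : g ∈ Gs.carrier) {z : List Γ.E}
    (hz : Γ.IsPathFrom g.cod z) : T.star (T.P g.cod z) * T.ιG g ≠ 0 := by
  intro h
  apply T.V_ne_zero (Γ.rng0 g.cod z)
  rw [← star_P_mul_P T hz, ← star_P_mul_V T hz, ← G_mul_G_symm T hg, ← _root_.mul_assoc, h, MulZeroClass.zero_mul,
    MulZeroClass.zero_mul]

/-- The data `(v, w, p, q, g)` of an element `p g q*` in canonical form. -/
structure IsCanon (v w : Γ.V) (p q : List Γ.E) (g : Arrow Γ) : Prop where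
  left : Γ.IsPathFrom v p
  right : Γ.IsPathFrom w q
  mem : g ∈ Gs.carrier
  dom_eq : g.dom = Γ.rng0 w q
  cod_eq : g.cod = Γ.rng0 v p

/-- The element `p g q*`. -/
def canon (v w : Γ.V) (p q : List Γ.E) (g : Arrow Γ) : T.S :=
  T.P v p * T.ιG g * T.star (T.P w q)

theorem exists_canon {s : T.S} (hs : s ≠ 0) :
    ∃ v w p q g, IsCanon (Gs := Gs) v w p q g ∧ s = T.canon v w p q g := by
  obtain ⟨v, w, p, q, g, h₁, h₂, h₃, h₄, h₅, h⟩ := T.canon_ex s hs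
  exact ⟨v, w, p, q, g, ⟨h₁, h₂, h₃, h₄, h₅⟩, h⟩

variable {T}

theorem IsCanon.star_P_mul {v w : Γ.V} {p q : List Γ.E} {g : Arrow Γ}
    (h : IsCanon (Gs := Gs) v w p q g) :
    T.star (T.P v p) * T.canon v w p q g = T.ιG g * T.star (T.P w q) := by
  rw [canon, ← _root_.mul_assoc, ← _root_.mul_assoc, star_P_mul_P T h.left, ← h.cod_eq, V_mul_G T h.mem]

theorem IsCanon.mul_P {v w : Γ.V} {p q : List Γ.E} {g : Arrow Γ}
    (h : IsCanon (Gs := Gs) v w p q g) :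
    T.canon v w p q g * T.P w q = T.P v p * T.ιG g := by
  rw [canon, _root_.mul_assoc, star_P_mul_P T h.right, ← h.dom_eq, _root_.mul_assoc, G_mul_V T h.mem]

theorem IsCanon.V_mul {v w : Γ.V} {p q : List Γ.E} {g : Arrow Γ}
    (h : IsCanon (Gs := Gs) v w p q g) :
    T.ιV v * T.canon v w p q g = T.canon v w p q g := by
  rw [canon, ← _root_.mul_assoc, ← _root_.mul_assoc, V_mul_P T h.left]

theorem IsCanon.mul_V {v w : Γ.V} {p q : List Γ.E} {g : Arrow Γ}
    (h : IsCanon (Gs := Gs) v w p q g) :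
    T.canon v w p q g * T.ιV w = T.canon v w p q g := by
  rw [canon, _root_.mul_assoc, star_P_mul_V T h.right]

theorem IsCanon.star_P_mul_P {v w : Γ.V} {p q : List Γ.E} {g : Arrow Γ}
    (h : IsCanon (Gs := Gs) v w p q g) :
    T.star (T.P v p) * T.canon v w p q g * T.P w q = T.ιG g := by
  rw [h.star_P_mul, _root_.mul_assoc, AssocISG.star_P_mul_P T h.right, ← h.dom_eq, G_mul_V T h.mem]

variable (T)

/-- The idempotent of a nonempty path is not a vertex. -/
theorem nil_of_P_mul_star_P {v : Γ.V} {p : List Γ.E} (hp : Γ.IsPathFrom v p)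
    (h : T.P v p * T.star (T.P v p) = T.ιV v) : p = [] := by
  refine (T.canon_inj v v v v p p [] [] (Arrow.idArrow Γ (Γ.rng0 v p)) (Arrow.idArrow Γ v)
    hp hp (Gs.id_mem _) rfl rfl trivial trivial (Gs.id_mem _) rfl rfl ?_).2.2.1
  change T.P v p * T.ιG _ * T.star (T.P v p) = T.ιV v * T.ιG _ * T.star (T.ιV v)
  rw [T.rel_id, T.rel_id, P_mul_V, h, star_V, V_mul_V, V_mul_V]

/-! ### The largest congruence in which zero is isolated -/

/-- `a` and `b` are annihilated by the same two-sided multiplications. -/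
def SameZeros (a b : T.S) : Prop := ∀ x y : T.S, x * a * y = 0 ↔ x * b * y = 0

theorem isCongruence_sameZeros : T.IsCongruence T.SameZeros := by
  refine ⟨⟨fun _ _ _ => Iff.rfl, fun h x y => (h x y).symm,
    fun h h' x y => (h x y).trans (h' x y)⟩, fun a b c h => ⟨fun x y => ?_, fun x y => ?_⟩⟩
  · change x * (c * a) * y = 0 ↔ x * (c * b) * y = 0
    simpa only [_root_.mul_assoc] using h (x * c) y
  · change x * (a * c) * y = 0 ↔ x * (b * c) * y = 0
    simpa only [_root_.mul_assoc] using h x (c * y)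

theorem eq_zero_of_sameZeros {a : T.S} (h : T.SameZeros a 0) : a = 0 := by
  have h' := (h (a * T.star a) (T.star a * a)).2 (by simp)
  rwa [_root_.mul_assoc, mul_star_mul, _root_.mul_assoc, mul_star_mul] at h'

theorem sameZeros_vertex_of_existsUnique {v : Γ.V} {e : Γ.E} (he : Γ.src e = v)
    (huniq : ∀ f, Γ.src f = v → f = e) :
    T.SameZeros (T.ιV v) (T.ιE e * T.star (T.ιE e)) := by
  set i := T.ιE e * T.star (T.ιE e) with hi
  have hvi : T.ιV v * i = i := by rw [hi, ← he, ← _root_.mul_assoc, V_mul_E]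
  have hiv : i * T.ιV v = i := by rw [hi, ← he, _root_.mul_assoc, star_E_mul_V]
  have hii : T.star (T.ιE e) * i = T.star (T.ιE e) := T.star_mul_star _
  have hiE : i * T.ιE e = T.ιE e := by rw [hi, _root_.mul_assoc, mul_star_mul]
  have hi0 : i ≠ 0 := by
    intro h
    apply T.V_ne_zero (Γ.rng e)
    rw [← star_E_mul_E, ← hiE, h, MulZeroClass.zero_mul, MulZeroClass.mul_zero]
  have hstar : ∀ q, q ≠ [] → Γ.IsPathFrom v q → T.star (T.P v q) * i = T.star (T.P v q) := by
    rintro (_ | ⟨f, q⟩) hq hp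
    · exact absurd rfl hq
    · obtain rfl := huniq f hp.1
      rw [star_P_cons T _ _ hp.2, _root_.mul_assoc, hii]
  have hP : ∀ q, q ≠ [] → Γ.IsPathFrom v q → i * T.P v q = T.P v q := by
    rintro (_ | ⟨f, q⟩) hq hp
    · exact absurd rfl hq
    · obtain rfl := huniq f hp.1
      rw [P_cons, ← _root_.mul_assoc, hiE]
  intro x y
  by_cases hx : x * T.ιV v = 0
  · rw [hx, ← hvi, ← _root_.mul_assoc, hx]; simp
  by_cases hy : T.ιV v * y = 0
  · rw [_root_.mul_assoc, hy, ← hiv, _root_.mul_assoc, _root_.mul_assoc, hy]; simp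
  obtain ⟨v₁, w₁, p, q, g, hc, rfl⟩ := T.exists_canon (left_ne_zero_of_mul hx)
  obtain ⟨v₂, w₂, p', q', g', hc', rfl⟩ := T.exists_canon (right_ne_zero_of_mul hy)
  obtain rfl : w₁ = v := by
    by_contra h
    rw [← hc.mul_V, _root_.mul_assoc, V_mul_V_of_ne T h, MulZeroClass.mul_zero] at hx
    exact hx rfl
  obtain rfl : v₂ = w₁ := by
    by_contra h
    rw [← hc'.V_mul, ← _root_.mul_assoc, V_mul_V_of_ne T (Ne.symm h), MulZeroClass.zero_mul] at hy
    exact hy rfl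
  by_cases hq : q = []
  · by_cases hp' : p' = []
    · subst hq hp'
      have key : ∀ j : T.S, T.ιV v₂ * j = j → j * T.ιV v₂ = j → j ≠ 0 →
          T.canon v₁ v₂ p [] g * j * T.canon v₂ w₂ [] q' g' ≠ 0 := by
        intro j h₁ h₂ hj h0
        apply hj
        have hd : g.dom = v₂ := hc.dom_eq
        have hd' : g'.cod = v₂ := hc'.cod_eq
        have e₁ : T.ιG g.symm * (T.star (T.P v₁ p) * T.canon v₁ v₂ p [] g) = T.ιV v₂ := by
          rw [hc.star_P_mul, P_nil, star_V, ← _root_.mul_assoc, G_symm_mul_G T hc.mem, hd, V_mul_V]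
        have e₂ : T.canon v₂ w₂ [] q' g' * T.P w₂ q' * T.ιG g'.symm = T.ιV v₂ := by
          rw [hc'.mul_P, P_nil, _root_.mul_assoc, G_mul_G_symm T hc'.mem, hd', V_mul_V]
        calc j = T.ιV v₂ * j * T.ιV v₂ := by rw [h₁, h₂]
          _ = T.ιG g.symm * T.star (T.P v₁ p) *
              (T.canon v₁ v₂ p [] g * j * T.canon v₂ w₂ [] q' g') *
              (T.P w₂ q' * T.ιG g'.symm) := by
            rw [← e₂]
            nth_rw 1 [e₂, ← e₁]
            simp only [_root_.mul_assoc]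
          _ = 0 := by rw [h0, MulZeroClass.mul_zero, MulZeroClass.zero_mul]
      exact iff_of_false (key _ (T.V_mul_V _) (T.V_mul_V _) (T.V_ne_zero _))
        (key _ hvi hiv hi0)
    · rw [_root_.mul_assoc, _root_.mul_assoc _ i, hc'.V_mul]
      have : i * T.canon v₂ w₂ p' q' g' = T.canon v₂ w₂ p' q' g' := by
        rw [canon, ← _root_.mul_assoc, ← _root_.mul_assoc, hP _ hp' hc'.left]
      rw [this]
  · have : T.canon v₁ v₂ p q g * i = T.canon v₁ v₂ p q g := by
      rw [canon, _root_.mul_assoc, hstar _ hq hc.right]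
    rw [this, hc.mul_V]

/-! ### Separating elements by their zeros -/

theorem star_P_mul_P_of_ne {v v' : Γ.V} (h : v ≠ v') {p p' : List Γ.E}
    (hp : Γ.IsPathFrom v p) (hp' : Γ.IsPathFrom v' p') :
    T.star (T.P v p) * T.P v' p' = 0 := by
  rw [← star_P_mul_V T hp, ← V_mul_P T hp', _root_.mul_assoc, ← _root_.mul_assoc (T.ιV v), V_mul_V_of_ne T h,
    MulZeroClass.zero_mul, MulZeroClass.mul_zero]

theorem star_P_cons_mul_P_cons (v v' : Γ.V) {e e' : Γ.E} (h : e ≠ e') {p p' : List Γ.E}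
    (hp : Γ.IsPathFrom (Γ.rng e) p) : T.star (T.P v (e :: p)) * T.P v' (e' :: p') = 0 := by
  rw [star_P_cons T v e hp, P_cons, _root_.mul_assoc, ← _root_.mul_assoc (T.star (T.ιE e)),
    star_E_mul_E_of_ne T h, MulZeroClass.zero_mul, MulZeroClass.mul_zero]

theorem star_P_cons_mul_P_cons_self (v v' : Γ.V) (e : Γ.E) {p p' : List Γ.E}
    (hp : Γ.IsPathFrom (Γ.rng e) p) (hp' : Γ.IsPathFrom (Γ.rng e) p') :
    T.star (T.P v (e :: p)) * T.P v' (e :: p') =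
      T.star (T.P (Γ.rng e) p) * T.P (Γ.rng e) p' := by
  rw [star_P_cons T v e hp, P_cons, _root_.mul_assoc, ← _root_.mul_assoc (T.star (T.ιE e)), star_E_mul_E,
    V_mul_P T hp']

theorem star_P_mul_P_of_length_eq {v : Γ.V} {p p' : List Γ.E} (hp : Γ.IsPathFrom v p)
    (hp' : Γ.IsPathFrom v p') (hlen : p.length = p'.length) (hne : p ≠ p') :
    T.star (T.P v p) * T.P v p' = 0 := by
  induction p generalizing v p' with
  | nil => exact absurd (List.length_eq_zero_iff.1 hlen.symm).symm hne
  | cons e p ih =>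
    cases p' with
    | nil => simp at hlen
    | cons e' p' =>
      by_cases h : e = e'
      · subst h
        rw [star_P_cons_mul_P_cons_self T v v e hp.2 hp'.2]
        exact ih hp.2 hp'.2 (by simpa using hlen) (by simpa using hne)
      · exact star_P_cons_mul_P_cons T v v h hp.2

/-- Some extension of the path `p` is incomparable with the path `p'`. -/
def Escapes (v v' : Γ.V) (p p' : List Γ.E) : Prop :=
  ∃ z, Γ.IsPathFrom (Γ.rng0 v p) z ∧ T.star (T.P v (p ++ z)) * T.P v' p' = 0 ∧
    T.star (T.P v' p') * T.P v (p ++ z) = 0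

theorem escapes_nil (hΓ : ∀ v : Γ.V, ¬ ∃! e : Γ.E, Γ.src e = v) {v : Γ.V} {e : Γ.E}
    {p : List Γ.E} (hp : Γ.IsPathFrom v (e :: p)) : T.Escapes v v [] (e :: p) := by
  obtain ⟨f, hf, hne⟩ : ∃ f, Γ.src f = v ∧ f ≠ e := by
    by_contra! h
    exact hΓ v ⟨e, hp.1, h⟩
  exact ⟨[f], ⟨hf, trivial⟩, T.star_P_cons_mul_P_cons v v hne trivial,
    T.star_P_cons_mul_P_cons v v hne.symm hp.2⟩

theorem escapes_or_escapes (hΓ : ∀ v : Γ.V, ¬ ∃! e : Γ.E, Γ.src e = v) {v v' : Γ.V}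
    {p p' : List Γ.E} (hp : Γ.IsPathFrom v p) (hp' : Γ.IsPathFrom v' p')
    (hne : ¬ (v = v' ∧ p = p')) : T.Escapes v v' p p' ∨ T.Escapes v' v p' p := by
  by_cases hv : v = v'
  · subst hv
    have hne : p ≠ p' := fun h => hne ⟨rfl, h⟩
    induction p generalizing v p' with
    | nil =>
      cases p' with
      | nil => exact absurd rfl hne
      | cons e p' => exact .inl (T.escapes_nil hΓ hp')
    | cons e p ih =>
      cases p' with
      | nil => exact .inr (T.escapes_nil hΓ hp)
      | cons e' p' =>
        by_cases h : e = e'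
        · subst h
          have key : ∀ {r s : List Γ.E}, Γ.IsPathFrom (Γ.rng e) r → Γ.IsPathFrom (Γ.rng e) s →
              T.Escapes (Γ.rng e) (Γ.rng e) r s → T.Escapes v v (e :: r) (e :: s) := by
            rintro r s hr hs ⟨z, hz, h₁, h₂⟩
            have hrz := DirGraph.isPathFrom_append.2 ⟨hr, hz⟩
            refine ⟨z, hz, ?_, ?_⟩
            · rwa [List.cons_append, star_P_cons_mul_P_cons_self T v v e hrz hs]
            · rwa [List.cons_append, star_P_cons_mul_P_cons_self T v v e hs hrz]
          have hne' : p ≠ p' := by simpa using hne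
          exact (ih hp.2 hp'.2 (fun h => hne' h.2) hne').imp (key hp.2 hp'.2) (key hp'.2 hp.2)
        · refine .inl ⟨[], trivial, ?_, ?_⟩
          · rw [List.append_nil]; exact T.star_P_cons_mul_P_cons v v h hp.2
          · rw [List.append_nil]; exact T.star_P_cons_mul_P_cons v v (Ne.symm h) hp'.2
  · refine .inl ⟨[], trivial, ?_, ?_⟩
    · rw [List.append_nil]; exact T.star_P_mul_P_of_ne hv hp hp'
    · rw [List.append_nil]; exact T.star_P_mul_P_of_ne (Ne.symm hv) hp' hp

variable {T}

theorem IsCanon.not_escapes_left {v w v' w' : Γ.V} {p q p' q' : List Γ.E} {g g' : Arrow Γ}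
    (h : IsCanon (Gs := Gs) v w p q g)
    (hz : T.SameZeros (T.canon v w p q g) (T.canon v' w' p' q' g')) :
    ¬ T.Escapes v v' p p' := by
  rintro ⟨z, hpz, h₀, -⟩
  have hb : T.star (T.P v (p ++ z)) * T.canon v' w' p' q' g' * T.P w q = 0 := by
    rw [canon, ← _root_.mul_assoc, ← _root_.mul_assoc, h₀]
    simp only [MulZeroClass.zero_mul]
  have ha := (hz _ _).2 hb
  rw [star_P_append T h.left hpz, _root_.mul_assoc (T.star _), h.star_P_mul, _root_.mul_assoc,
    _root_.mul_assoc (T.ιG g), AssocISG.star_P_mul_P T h.right, ← h.dom_eq, G_mul_V T h.mem,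
    ← h.cod_eq] at ha
  exact T.star_P_mul_G_ne_zero h.mem (h.cod_eq ▸ hpz) ha

theorem IsCanon.not_escapes_right {v w v' w' : Γ.V} {p q p' q' : List Γ.E} {g g' : Arrow Γ}
    (h : IsCanon (Gs := Gs) v w p q g)
    (hz : T.SameZeros (T.canon v w p q g) (T.canon v' w' p' q' g')) :
    ¬ T.Escapes w w' q q' := by
  rintro ⟨z, hqz, -, h₀⟩
  have hb : T.star (T.P v p) * T.canon v' w' p' q' g' * T.P w (q ++ z) = 0 := by
    rw [canon, _root_.mul_assoc, _root_.mul_assoc (T.P v' p' * _), h₀, MulZeroClass.mul_zero, MulZeroClass.mul_zero]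
  have ha := (hz _ _).2 hb
  rw [P_append T w q hqz, ← _root_.mul_assoc, h.star_P_mul_P, ← h.dom_eq] at ha
  exact T.G_mul_P_ne_zero h.mem (h.dom_eq ▸ hqz) ha

variable (T)

/-- When no vertex emits exactly one edge, elements are determined by their zeros. -/
theorem eq_of_sameZeros (hΓ : ∀ v : Γ.V, ¬ ∃! e : Γ.E, Γ.src e = v) {a b : T.S}
    (hab : T.SameZeros a b) : a = b := by
  have hba : T.SameZeros b a := fun x y => (hab x y).symm
  by_cases ha : a = 0
  · subst ha; exact (T.eq_zero_of_sameZeros hba).symm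
  by_cases hb : b = 0
  · subst hb; exact T.eq_zero_of_sameZeros hab
  obtain ⟨v, w, p, q, g, hc, rfl⟩ := T.exists_canon ha
  obtain ⟨v', w', p', q', g', hc', rfl⟩ := T.exists_canon hb
  obtain ⟨rfl, rfl⟩ : v = v' ∧ p = p' := by
    by_contra h
    exact (T.escapes_or_escapes hΓ hc.left hc'.left h).elim
      (hc.not_escapes_left hab) (hc'.not_escapes_left hba)
  obtain ⟨rfl, rfl⟩ : w = w' ∧ q = q' := by
    by_contra h
    exact (T.escapes_or_escapes hΓ hc.right hc'.right h).elim
      (hc.not_escapes_right hab) (hc'.not_escapes_right hba)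
  have hdom : g.dom = g'.dom := hc.dom_eq.trans hc'.dom_eq.symm
  have hcod : g.cod = g'.cod := hc.cod_eq.trans hc'.cod_eq.symm
  have hsame : g.Same g' := by
    refine ⟨hdom, hcod, fun z hz => ?_⟩
    by_contra hne
    have hz' : Γ.IsPathFrom g'.dom z := hdom ▸ hz
    obtain ⟨hlen, k, hk, -, hkc, hkP⟩ := T.G_mul_P hc.mem hz
    obtain ⟨hlen', k', hk', -, -, hkP'⟩ := T.G_mul_P hc'.mem hz'
    have hgz := g.act_maps z hz
    have hgz' : Γ.IsPathFrom g.cod (g'.act z) := hcod ▸ g'.act_maps z hz'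
    have h₀ := hab (T.star (T.P g.cod (g.act z)) * T.star (T.P v p)) (T.P w q * T.P g.dom z)
    have expand : ∀ h : Arrow Γ, IsCanon (Gs := Gs) v w p q h →
        T.star (T.P g.cod (g.act z)) * T.star (T.P v p) * T.canon v w p q h *
          (T.P w q * T.P g.dom z) =
        T.star (T.P g.cod (g.act z)) * (T.ιG h * T.P g.dom z) := by
      intro h hh
      rw [← hh.star_P_mul_P]
      simp only [_root_.mul_assoc]
    rw [expand g hc, expand g' hc', hkP] at h₀
    rw [hdom, hkP', ← hcod, ← _root_.mul_assoc, ← _root_.mul_assoc, star_P_mul_P T hgz,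
      T.star_P_mul_P_of_length_eq hgz hgz' (hlen.trans hlen'.symm) hne, MulZeroClass.zero_mul, ← hkc,
      V_mul_G T hk] at h₀
    exact T.G_ne_zero hk (h₀.2 rfl)
  rw [canon, canon, T.ιG_same g g' hsame]

/-! ### Ideals -/

/-- Membership of a vertex in the ideal of another one yields a path and an arrow. -/
theorem exists_arrow_of_eq_mul {v w : Γ.V} {a b : T.S} (h : T.ιV v = a * T.ιV w * b) :
    ∃ q, Γ.IsPathFrom w q ∧ ∃ g ∈ Gs.carrier, g.dom = Γ.rng0 w q ∧ g.cod = v := by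
  have hv := T.V_ne_zero v
  have ha : a ≠ 0 := by
    rintro rfl
    exact hv (by rw [h, MulZeroClass.zero_mul, MulZeroClass.zero_mul])
  obtain ⟨u, w', p, q, g, hc, rfl⟩ := T.exists_canon ha
  obtain rfl : w' = w := by
    by_contra hne
    apply hv
    rw [h, ← hc.mul_V, _root_.mul_assoc (T.canon _ _ _ _ _), V_mul_V_of_ne T hne, MulZeroClass.mul_zero, MulZeroClass.zero_mul]
  obtain rfl : u = v := by
    by_contra hne
    apply hv
    rw [← V_mul_V_of_ne T hne, h, ← _root_.mul_assoc, ← _root_.mul_assoc, hc.V_mul]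
  have hp : T.P u p * T.star (T.P u p) = T.ιV u := by
    rw [← star_P_mul_V T hc.left, ← _root_.mul_assoc]
    nth_rw 2 [h]
    rw [h]
    rw [_root_.mul_assoc (T.P u p), ← _root_.mul_assoc (T.star _), ← _root_.mul_assoc (T.star _), hc.star_P_mul, canon]
    simp only [_root_.mul_assoc]
  obtain rfl := T.nil_of_P_mul_star_P hc.left hp
  exact ⟨q, hc.right, g, hc.mem, hc.dom_eq, hc.cod_eq⟩

theorem exists_arrow_of_congruenceFree (hT : T.CongruenceFree) (v w : Γ.V) :
    ∃ q, Γ.IsPathFrom w q ∧ ∃ g ∈ Gs.carrier, g.dom = Γ.rng0 w q ∧ g.cod = v := by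
  let J : Set T.S := {s | ∃ a b, s = a * T.ιV w * b}
  have hl : ∀ c s, s ∈ J → c * s ∈ J := by
    rintro c _ ⟨a, b, rfl⟩
    exact ⟨c * a, b, by simp only [_root_.mul_assoc]⟩
  have hr : ∀ c s, s ∈ J → s * c ∈ J := by
    rintro c _ ⟨a, b, rfl⟩
    exact ⟨a, b * c, by simp only [_root_.mul_assoc]⟩
  have hw : T.ιV w ∈ J := ⟨T.ιV w, T.ιV w, by rw [V_mul_V, V_mul_V]⟩
  have h0 : (0 : T.S) ∈ J := ⟨0, 0, by simp⟩
  have hcong : T.IsCongruence fun a b => a = b ∨ (a ∈ J ∧ b ∈ J) := by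
    refine ⟨⟨fun _ => .inl rfl, ?_, ?_⟩, ?_⟩
    · rintro a b (h | h)
      · exact .inl h.symm
      · exact .inr h.symm
    · rintro a b c (rfl | h) (rfl | h')
      · exact .inl rfl
      · exact .inr h'
      · exact .inr h
      · exact .inr ⟨h.1, h'.2⟩
    · rintro a b c (rfl | h)
      · exact ⟨.inl rfl, .inl rfl⟩
      · exact ⟨.inr ⟨hl c a h.1, hl c b h.2⟩, .inr ⟨hr c a h.1, hr c b h.2⟩⟩
  rcases hT _ hcong with h | h
  · exact absurd ((h _ _).1 (.inr ⟨hw, h0⟩)) (T.V_ne_zero w)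
  · rcases h (T.ιV v) 0 with h | ⟨⟨a, b, h⟩, -⟩
    · exact absurd h (T.V_ne_zero v)
    · exact T.exists_arrow_of_eq_mul h

/-- Under the orbit condition, a congruence identifying a nonzero element with zero is
universal. -/
theorem rel_zero_of_orbitCond (hG : OrbitCond Γ Gs) {r : T.S → T.S → Prop}
    (hr : T.IsCongruence r) {s : T.S} (hs : s ≠ 0) (hs0 : r s 0) (t : T.S) : r t 0 := by
  have hl : ∀ c {a : T.S}, r a 0 → r (c * a) 0 := fun c a h => by
    have : r (c * a) (c * 0) := (hr.2 a 0 c h).1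
    rwa [MulZeroClass.mul_zero] at this
  have hm : ∀ c {a : T.S}, r a 0 → r (a * c) 0 := fun c a h => by
    have : r (a * c) (0 * c) := (hr.2 a 0 c h).2
    rwa [MulZeroClass.zero_mul] at this
  obtain ⟨v, w, p, q, g, hc, rfl⟩ := T.exists_canon hs
  have hV : r (T.ιV g.dom) 0 := by
    rw [← G_symm_mul_G T hc.mem, ← hc.star_P_mul_P (T := T)]
    exact hl _ (hm _ (hl _ hs0))
  have hall : ∀ u, r (T.ιV u) 0 := by
    intro u
    by_cases hu : g.dom = u
    · exact hu ▸ hV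
    obtain ⟨q, hq, k, hk, hkd, rfl⟩ := (hG _ _ hu).2
    rw [← G_mul_G_symm T hk, ← G_mul_V T hk, hkd, ← star_P_mul_P T hq, ← V_mul_P T hq]
    exact hm _ (hl _ (hl _ (hm _ hV)))
  by_cases ht : t = 0
  · rw [ht]; exact hr.1.refl 0
  obtain ⟨v', w', p', q', g', hc', rfl⟩ := T.exists_canon ht
  rw [← hc'.V_mul]
  exact hm _ (hall v')

end AssocISG

/-- Theorem: `S_{(G,Γ*)}` is congruence-free iff `|s⁻¹(v)| ≠ 1` for all `v ∈ Γ⁰` and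
for each pair of distinct vertices `v, w` there exist `p ∈ wΓ*`, `q ∈ vΓ*` with
`G ∩ Iso(r(p), v) ≠ ∅` and `G ∩ Iso(r(q), w) ≠ ∅`. -/
theorem statement0 (Γ : DirGraph) (Gs : SSG Γ) (T : AssocISG Γ Gs) :
    T.CongruenceFree ↔
      ((∀ v : Γ.V, ¬ ∃! e : Γ.E, Γ.src e = v) ∧ OrbitCond Γ Gs) := by
  constructor
  · intro hT
    refine ⟨?_, fun v w _ => ⟨T.exists_arrow_of_congruenceFree hT v w,
      T.exists_arrow_of_congruenceFree hT w v⟩⟩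
    rintro v ⟨e, he, huniq⟩
    have hsame := T.sameZeros_vertex_of_existsUnique he huniq
    rcases hT _ T.isCongruence_sameZeros with h | h
    · have hpath : Γ.IsPathFrom v [e] := ⟨he, trivial⟩
      have hnil : [e] = [] := T.nil_of_P_mul_star_P hpath (by
        rw [T.P_cons, T.P_nil, T.E_mul_V]
        exact ((h _ _).1 hsame).symm)
      simp at hnil
    · exact T.V_ne_zero v (T.eq_zero_of_sameZeros (h _ _))
  · rintro ⟨hΓ, hG⟩ r hr
    by_cases h : ∃ s : T.S, s ≠ 0 ∧ r s 0
    · obtain ⟨s, hs, hs0⟩ := h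
      have hall := T.rel_zero_of_orbitCond hG hr hs hs0
      exact .inr fun a b => hr.1.trans (hall a) (hr.1.symm (hall b))
    · push Not at h
      have hzero : ∀ s : T.S, r s 0 → s = 0 := fun s hs => by_contra fun h' => h s h' hs
      refine .inl fun a b => ⟨fun hab => T.eq_of_sameZeros hΓ fun x y => ?_,
        fun hab => hab ▸ hr.1.refl a⟩
      have hxy : r (x * a * y) (x * b * y) := (hr.2 _ _ y (hr.2 _ _ x hab).1).2
      exact ⟨fun h0 => hzero _ (hr.1.symm (h0 ▸ hxy)), fun h0 => hzero _ (h0 ▸ hxy)⟩
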